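/- arXiv:2106.04218 — 2 statements merged into one kernel-verified Lean document; each statement's English description precedes it below -/
import Mathlib

section
/- For 0 ≤ β ≤ 14.4, the Gram-Charlier-like expansion φ(x,β) = (1 + (β/576)·(x⁴ − 14x² + 9))·(1/2)·sech(πx/2) is nonnegative for all real x, and it integrates to 1; hence it is a probability density. -/
open MeasureTheory Real

noncomputable def hsDensity (x : ℝ) : ℝ := (1 / 2) * (Real.cosh (Real.pi * x / 2))⁻¹

noncomputable def gchs (x β : ℝ) : ℝ :=
  (1 + (β / 576) * (x ^ 4 - 14 * x ^ 2 + 9)) * hsDensity x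

lemma bern5 : (Polynomial.bernoulli 5).eval (1 / 4) = -25 / 1024 := by
  simp_rw [Polynomial.bernoulli, Finset.sum_range_succ, Polynomial.eval_add,
    Polynomial.eval_monomial]
  have h5 : bernoulli' 5 = 0 := by
    rw [bernoulli'_def]
    norm_num [Finset.sum_range_succ, Finset.sum_range_succ', Nat.choose]
  rw [Finset.sum_range_zero, Polynomial.eval_zero, zero_add, _root_.bernoulli_one]
  rw [bernoulli_eq_bernoulli'_of_ne_one zero_ne_one, bernoulli'_zero,
    bernoulli_eq_bernoulli'_of_ne_one (by decide : 2 ≠ 1), bernoulli'_two,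
    bernoulli_eq_bernoulli'_of_ne_one (by decide : 3 ≠ 1), bernoulli'_three,
    bernoulli_eq_bernoulli'_of_ne_one (by decide : 4 ≠ 1), bernoulli'_four,
    bernoulli_eq_bernoulli'_of_ne_one (by decide : 5 ≠ 1), h5]
  norm_num [Nat.choose]

lemma L5 : HasSum (fun n : ℕ => (1 : ℝ) / (n : ℝ) ^ 5 * Real.sin (π * n / 2))
    (5 * π ^ 5 / 1536) := by
  apply (congr_arg₂ HasSum ?_ ?_).to_iff.mp <|
    hasSum_one_div_nat_pow_mul_sin two_ne_zero (?_ : 1 / 4 ∈ Set.Icc (0 : ℝ) 1)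
  · ext1 n
    ring_nf
  · have : (1 / 4 : ℝ) = (algebraMap ℚ ℝ) (1 / 4 : ℚ) := by simp
    rw [this, mul_pow, Polynomial.eval_map, Polynomial.eval₂_at_apply, (by decide : 2 * 2 + 1 = 5),
      bern5]
    simp [Nat.factorial]; ring
  · rw [Set.mem_Icc]; constructor
    · linarith
    · linarith

lemma sinsum {q : ℝ} (h0 : 0 < q) (h1 : q < 1) :
    HasSum (fun n : ℕ => Real.sin (π * n / 2) * q ^ n) (q / (1 + q ^ 2)) := by
  have hn : ‖Complex.I * (q : ℂ)‖ < 1 := by simp [abs_of_pos h0, h1]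
  have h := Complex.hasSum_im (hasSum_geometric_of_norm_lt_one hn)
  have hp : 1 + q ^ 2 ≠ 0 := by positivity
  convert h using 1
  · ext n
    have hI : Complex.I ^ n = Complex.exp (((π * n / 2 : ℝ) : ℂ) * Complex.I) := by
      conv_lhs => rw [← Complex.exp_pi_div_two_mul_I]
      rw [← Complex.exp_nat_mul]
      congr 1
      push_cast
      ring
    rw [mul_pow, hI, ← Complex.ofReal_pow, Complex.im_mul_ofReal, Complex.exp_ofReal_mul_I_im]
  · simp [Complex.inv_im, Complex.normSq_apply, pow_two]

lemma expint (k : ℕ) {r : ℝ} (hr : 0 < r) :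
    ∫ t : ℝ in Set.Ioi 0, t ^ k * exp (-(r * t)) = k.factorial / r ^ (k + 1) := by
  have h := Real.integral_rpow_mul_exp_neg_mul_Ioi (a := (k : ℝ) + 1) (by positivity) hr
  rw [Real.Gamma_nat_eq_factorial] at h
  have e : (1 / r) ^ ((k : ℝ) + 1) = 1 / r ^ (k + 1) := by
    rw [← Nat.cast_add_one, Real.rpow_natCast]; simp
  rw [e] at h
  simp only [add_sub_cancel_right, Real.rpow_natCast] at h
  rw [h]; ring

lemma expintble (k : ℕ) {r : ℝ} (hr : 0 < r) :
    IntegrableOn (fun t : ℝ => t ^ k * exp (-(r * t))) (Set.Ioi 0) := by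
  by_contra h
  have := integral_undef h
  rw [expint k hr] at this
  exact absurd this (by positivity)

lemma halfmoment (k : ℕ) (hk : 1 ≤ k) {S : ℝ}
    (hS : HasSum (fun n : ℕ => (1 : ℝ) / (n : ℝ) ^ (k + 1) * Real.sin (π * n / 2)) S) :
    ∫ x in Set.Ioi (0 : ℝ), x ^ k * hsDensity x = k.factorial * (2 / π) ^ (k + 1) * S := by
  set F : ℕ → ℝ → ℝ := fun n x => Real.sin (π * n / 2) * (x ^ k * exp (-((π * n / 2) * x)))
    with hF
  have hint : ∀ n, Integrable (F n) (volume.restrict (Set.Ioi 0)) := by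
    intro n
    rcases Nat.eq_zero_or_pos n with rfl | hn
    · simp [hF]
    · have : 0 < π * n / 2 := by positivity
      exact (expintble k this).const_mul _
  have hval : ∀ n, ∫ x in Set.Ioi (0 : ℝ), F n x =
      k.factorial * (2 / π) ^ (k + 1) *
        ((1 : ℝ) / (n : ℝ) ^ (k + 1) * Real.sin (π * n / 2)) := by
    intro n
    rcases Nat.eq_zero_or_pos n with rfl | hn
    · simp [hF]
    · have : 0 < π * n / 2 := by positivity
      simp only [hF]
      rw [integral_const_mul, expint k this, div_pow, mul_pow, div_pow]
      field_simp
  have hnorm : ∀ n, ∫ x in Set.Ioi (0 : ℝ), ‖F n x‖ ≤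
      k.factorial * (2 / π) ^ (k + 1) * ((1 : ℝ) / (n : ℝ) ^ (k + 1)) := by
    intro n
    rcases Nat.eq_zero_or_pos n with rfl | hn
    · simp [hF]
    · have hp : 0 < π * n / 2 := by positivity
      have e : ∫ x in Set.Ioi (0 : ℝ), ‖F n x‖ =
          |Real.sin (π * n / 2)| * (k.factorial / (π * n / 2) ^ (k + 1)) := by
        rw [← expint k hp, ← integral_const_mul]
        refine setIntegral_congr_fun measurableSet_Ioi fun x hx => ?_
        have hx : 0 < x := hx
        simp only [hF, Real.norm_eq_abs, abs_mul]
        rw [abs_of_nonneg (by positivity : 0 ≤ x ^ k), abs_of_pos (exp_pos _)]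
      rw [e]
      calc _ ≤ 1 * (k.factorial / (π * n / 2) ^ (k + 1)) := by
            gcongr
            exact Real.abs_sin_le_one _
        _ = _ := by rw [div_pow, mul_pow, div_pow]; field_simp
  have hsum : Summable fun n => ∫ x in Set.Ioi (0 : ℝ), ‖F n x‖ := by
    refine Summable.of_nonneg_of_le (fun n => integral_nonneg fun _ => norm_nonneg _) hnorm ?_
    exact (Real.summable_one_div_nat_pow.2 (by omega)).mul_left _
  have key := hasSum_integral_of_summable_integral_norm hint hsum
  simp only [hval] at key
  have hS' := hS.mul_left (k.factorial * (2 / π) ^ (k + 1))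
  rw [← key.unique hS']
  refine setIntegral_congr_fun measurableSet_Ioi fun x hx => ?_
  have hx : 0 < x := hx
  have hq : exp (-(π * x / 2)) < 1 := by
    rw [Real.exp_lt_one_iff]
    have : 0 < π * x / 2 := by positivity
    linarith
  have h := (sinsum (exp_pos _) hq).mul_left (x ^ k)
  have h2 : HasSum (fun n => F n x) (x ^ k * hsDensity x) := by
    have e1 : (fun n => F n x) =
        fun n : ℕ => x ^ k * (Real.sin (π * n / 2) * exp (-(π * x / 2)) ^ n) := by
      funext n
      rw [← Real.exp_nat_mul, show (n : ℝ) * (-(π * x / 2)) = -((π * n / 2) * x) by ring]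
      simp only [hF]
      ring
    have e2 : hsDensity x = exp (-(π * x / 2)) / (1 + exp (-(π * x / 2)) ^ 2) := by
      rw [hsDensity, Real.cosh_eq, Real.exp_neg]
      have := exp_pos (π * x / 2)
      field_simp
      try ring
    rw [e1, e2]
    exact h
  exact h2.tsum_eq.symm

lemma hs_abs (x : ℝ) : hsDensity |x| = hsDensity x := by
  rcases abs_choice x with h | h <;> rw [h]
  simp only [hsDensity]
  rw [show π * -x / 2 = -(π * x / 2) by ring, Real.cosh_neg]

lemma hs_nonneg (x : ℝ) : 0 ≤ hsDensity x := by
  have := Real.cosh_pos (π * x / 2)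
  rw [hsDensity]; positivity

lemma m0 : ∫ x : ℝ, hsDensity x = 1 := by
  have h := integral_comp_abs (f := hsDensity)
  simp only [hs_abs] at h
  rw [h]
  have hd : ∀ x ∈ Set.Ici (0 : ℝ), HasDerivAt (fun x => (2 / π) * arctan (exp (π * x / 2)))
      (hsDensity x) x := by
    intro x _
    have h1 : HasDerivAt (fun x : ℝ => π * x / 2) (π / 2) x := by
      simpa using ((hasDerivAt_id x).const_mul π).div_const 2
    refine ((h1.exp.arctan).const_mul (2 / π)).congr_deriv ?_
    rw [hsDensity, Real.cosh_eq, Real.exp_neg]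
    have := exp_pos (π * x / 2)
    field_simp
    try ring
  have ht : Filter.Tendsto (fun x => (2 / π) * arctan (exp (π * x / 2))) Filter.atTop
      (nhds ((2 / π) * (π / 2))) := by
    refine Filter.Tendsto.const_mul _ ?_
    refine (tendsto_nhds_of_tendsto_nhdsWithin tendsto_arctan_atTop).comp ?_
    refine tendsto_exp_atTop.comp ?_
    exact (Filter.tendsto_id.const_mul_atTop pi_pos).atTop_div_const two_pos
  rw [integral_Ioi_of_hasDerivAt_of_nonneg' hd (fun x _ => hs_nonneg x) ht]
  simp
  field_simp
  norm_num

lemma m2 : ∫ x : ℝ, x ^ 2 * hsDensity x = 1 := by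
  have h := integral_comp_abs (f := fun x => x ^ 2 * hsDensity x)
  simp only [hs_abs, sq_abs] at h
  rw [h, halfmoment 2 (by norm_num) hasSum_L_function_mod_four_eval_three]
  simp [Nat.factorial]
  field_simp
  norm_num

lemma m4 : ∫ x : ℝ, x ^ 4 * hsDensity x = 5 := by
  have h := integral_comp_abs (f := fun x => x ^ 4 * hsDensity x)
  have e : ∀ x : ℝ, |x| ^ 4 = x ^ 4 := fun x => (by decide : Even 4).pow_abs x
  simp only [hs_abs, e] at h
  rw [h, halfmoment 4 (by norm_num) L5]
  simp [Nat.factorial]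
  field_simp
  norm_num

theorem gchs_is_density {β : ℝ} (h0 : 0 ≤ β) (h1 : β ≤ 14.4) :
    (∀ x : ℝ, 0 ≤ gchs x β) ∧ ∫ x : ℝ, gchs x β = 1 := by
  constructor
  · intro x
    refine mul_nonneg ?_ (hs_nonneg x)
    norm_num at h1
    nlinarith [mul_nonneg h0 (sq_nonneg (x ^ 2 - 7))]
  · have i0 : Integrable hsDensity := by
      by_contra h
      have := integral_undef h
      rw [m0] at this
      norm_num at this
    have i2 : Integrable (fun x : ℝ => x ^ 2 * hsDensity x) := by
      by_contra h
      have := integral_undef h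
      rw [m2] at this
      norm_num at this
    have i4 : Integrable (fun x : ℝ => x ^ 4 * hsDensity x) := by
      by_contra h
      have := integral_undef h
      rw [m4] at this
      norm_num at this
    have e : ∀ x, gchs x β = (1 + β / 576 * 9) * hsDensity x
        + ((β / 576) * (x ^ 4 * hsDensity x) - (β / 576 * 14) * (x ^ 2 * hsDensity x)) := by
      intro x; rw [gchs]; ring
    simp only [e]
    have i42 : Integrable (fun x : ℝ => (β / 576) * (x ^ 4 * hsDensity x)
        - (β / 576 * 14) * (x ^ 2 * hsDensity x)) := (i4.const_mul _).sub (i2.const_mul _)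
    rw [integral_add (i0.const_mul _) i42,
      integral_sub (i4.const_mul _) (i2.const_mul _), integral_const_mul, integral_const_mul,
      integral_const_mul, m0, m2, m4]
    ring
end

section
/- The characteristic function of the Gram-Charlier-like expansion φ(x,β) = (1 + (β/576)·(x⁴−14x²+9))·(1/2)·sech(πx/2) equals sech(ω)·(1 + (β/24)·tanh(ω)⁴) for all real ω. -/
open MeasureTheory Real

lemma hs_pos (x : ℝ) : 0 < hsDensity x := by
  unfold hsDensity
  have := Real.cosh_pos (Real.pi * x / 2)
  positivity

lemma hs_cont : Continuous hsDensity := by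
  unfold hsDensity
  refine continuous_const.mul (Continuous.inv₀ (by fun_prop) fun x => (Real.cosh_pos _).ne')

lemma hs_eq (x : ℝ) : hsDensity x = Real.sigmoid (π * x) * Real.exp (-(π * x) / 2) := by
  unfold hsDensity
  rw [Real.sigmoid_def, Real.cosh_eq]
  have h1 : Real.exp (-(π * x)) = Real.exp (-(π * x) / 2) * Real.exp (-(π * x) / 2) := by
    rw [← Real.exp_add]; congr 1; ring
  have h2 : Real.exp (-(π * x) / 2) * Real.exp (π * x / 2) = 1 := by
    rw [← Real.exp_add, ← Real.exp_zero]; congr 1; ring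
  have h3 : -(π * x / 2) = -(π * x) / 2 := by ring
  rw [h1, h3]
  have hp := Real.exp_pos (-(π * x) / 2)
  have hq := Real.exp_pos (π * x / 2)
  generalize Real.exp (-(π * x) / 2) = p at *
  generalize Real.exp (π * x / 2) = q at *
  field_simp
  linear_combination -h2

lemma hs_le (x : ℝ) : hsDensity x ≤ Real.exp (-(3 / 2 * |x|)) := by
  unfold hsDensity
  have h1 : Real.exp (3 / 2 * |x|) ≤ 2 * Real.cosh (π * x / 2) := by
    rw [← Real.cosh_abs, Real.cosh_eq]
    have : Real.exp (3 / 2 * |x|) ≤ Real.exp |π * x / 2| := by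
      apply Real.exp_le_exp.2
      rw [abs_div, abs_mul, abs_of_pos Real.pi_pos, abs_of_pos (by norm_num : (0:ℝ) < 2)]
      nlinarith [Real.pi_gt_three, abs_nonneg x]
    have := Real.exp_pos (-|π * x / 2|)
    linarith
  rw [Real.exp_neg]
  have : (1 / 2) * (Real.cosh (Real.pi * x / 2))⁻¹ = (2 * Real.cosh (π * x / 2))⁻¹ := by
    rw [mul_inv]; norm_num
  rw [this]
  exact inv_anti₀ (Real.exp_pos _) h1

lemma int_exp_abs : Integrable (fun x : ℝ => Real.exp (-(1 / 2) * |x|)) := by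
  apply Integrable.of_integral_ne_zero
  rw [integral_comp_abs (f := fun x => Real.exp (-(1 / 2) * x)), integral_exp_mul_Ioi (by norm_num)]
  norm_num

lemma int_bound (n : ℕ) : Integrable (fun x : ℝ => |x| ^ n * hsDensity x) := by
  refine (int_exp_abs.const_mul (n.factorial : ℝ)).mono'
    ((by fun_prop : Continuous fun x : ℝ => |x| ^ n).mul hs_cont).aestronglyMeasurable
    (Filter.Eventually.of_forall fun x => ?_)
  have h1 := Real.pow_div_factorial_le_exp _ (abs_nonneg x) n
  rw [div_le_iff₀ (by positivity)] at h1
  have hp := hs_pos x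
  rw [Real.norm_of_nonneg (by positivity)]
  calc |x| ^ n * hsDensity x ≤ (Real.exp |x| * n.factorial) * Real.exp (-(3 / 2 * |x|)) :=
        mul_le_mul h1 (hs_le x) hp.le (by positivity)
    _ = n.factorial * (Real.exp |x| * Real.exp (-(3 / 2 * |x|))) := by ring
    _ = _ := by rw [← Real.exp_add]; congr 2; ring

noncomputable def kern (n : ℕ) (w x : ℝ) : ℂ :=
  Complex.exp (Complex.I * w * x) * ((x : ℂ) ^ n * (hsDensity x : ℂ))

lemma kern_cont (n : ℕ) (w : ℝ) : Continuous (kern n w) := by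
  unfold kern
  have := Complex.continuous_ofReal.comp hs_cont
  have h2 : Continuous fun x => (hsDensity x : ℂ) := this
  fun_prop

lemma kern_norm (n : ℕ) (w x : ℝ) : ‖kern n w x‖ = |x| ^ n * hsDensity x := by
  unfold kern
  rw [norm_mul, norm_mul, norm_pow, Complex.norm_real, Complex.norm_real,
    Real.norm_of_nonneg (hs_pos x).le, Complex.norm_exp]
  simp

lemma kern_int (n : ℕ) (w : ℝ) : Integrable (kern n w) :=
  (int_bound n).mono' (kern_cont n w).aestronglyMeasurable
    (Filter.Eventually.of_forall fun x => (kern_norm n w x).le)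

lemma G_deriv (n : ℕ) (w : ℝ) :
    HasDerivAt (fun w => ∫ x, kern n w x) (Complex.I * ∫ x, kern (n + 1) w x) w := by
  rw [← integral_const_mul]
  refine (hasDerivAt_integral_of_dominated_loc_of_deriv_le (s := Set.univ)
    (F' := fun w x => Complex.I * kern (n + 1) w x)
    (bound := fun x => |x| ^ (n + 1) * hsDensity x) Filter.univ_mem
    (Filter.Eventually.of_forall fun w => (kern_cont n w).aestronglyMeasurable) (kern_int n w)
    ((kern_int (n + 1) w).const_mul _).aestronglyMeasurable
    (Filter.Eventually.of_forall fun x w _ => ?_) (int_bound (n + 1))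
    (Filter.Eventually.of_forall fun x w _ => ?_)).2
  · rw [norm_mul, Complex.norm_I, one_mul, kern_norm]
  · unfold kern
    have h1 : HasDerivAt (fun w : ℝ => Complex.I * w * x) (Complex.I * 1 * x) w :=
      ((Complex.ofRealCLM.hasDerivAt (x := w)).const_mul Complex.I).mul_const (x : ℂ)
    convert! (h1.cexp).mul_const ((x : ℂ) ^ n * (hsDensity x : ℂ)) using 1
    ring

lemma G_zero (w : ℝ) : ∫ x, kern 0 w x = (((Real.cosh w)⁻¹ : ℝ) : ℂ) := by
  have hpi : (π : ℂ) ≠ 0 := by exact_mod_cast Real.pi_ne_zero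
  set a : ℂ := 1 / 2 + Complex.I * w / π with ha
  have ha1 : 1 - a = 1 / 2 - Complex.I * w / π := by rw [ha]; ring
  have hre : (Complex.I * w / π).re = 0 := by
    rw [Complex.div_ofReal_re]; simp
  have hB := Complex.Gamma_mul_Gamma_eq_betaIntegral (s := a) (t := 1 - a)
    (by rw [ha, Complex.add_re, hre]; norm_num) (by rw [ha1, Complex.sub_re, hre]; norm_num)
  rw [Complex.Gamma_mul_Gamma_one_sub, add_sub_cancel, Complex.Gamma_one, one_mul] at hB
  have hsin : Complex.sin (π * a) = Complex.cosh w := by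
    have : (π : ℂ) * a = w * Complex.I + π / 2 := by rw [ha]; field_simp; ring
    rw [this, Complex.sin_add_pi_div_two, Complex.cos_mul_I]
  have key := integral_image_eq_integral_abs_deriv_smul (s := Set.univ)
    (f := fun x => Real.sigmoid (π * x))
    (f' := fun x => Real.sigmoid (π * x) * (1 - Real.sigmoid (π * x)) * π) MeasurableSet.univ
    (fun x _ => by
      have h1 : HasDerivAt (fun x : ℝ => π * x) π x := by
        simpa using (hasDerivAt_id x).const_mul π
      exact ((Real.hasDerivAt_sigmoid (π * x)).comp x h1).hasDerivWithinAt)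
    (fun x _ y _ h => mul_left_cancel₀ Real.pi_ne_zero (Real.sigmoid_injective h))
    (fun x : ℝ => (x : ℂ) ^ (a - 1) * (1 - (x : ℂ)) ^ ((1 - a) - 1))
  have himg : (fun x => Real.sigmoid (π * x)) '' Set.univ = Set.Ioo 0 1 := by
    rw [← Real.range_sigmoid, Set.image_univ]
    exact (mul_left_surjective₀ Real.pi_ne_zero).range_comp Real.sigmoid
  rw [himg, setIntegral_univ, ← integral_Ioc_eq_integral_Ioo,
    ← intervalIntegral.integral_of_le zero_le_one] at key
  rw [Complex.betaIntegral, key, hsin] at hB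
  have hpt : ∀ x : ℝ, |Real.sigmoid (π * x) * (1 - Real.sigmoid (π * x)) * π| •
      ((Real.sigmoid (π * x) : ℂ) ^ (a - 1) * (1 - (Real.sigmoid (π * x) : ℂ)) ^ ((1 - a) - 1))
      = π * kern 0 w x := by
    intro x
    have hs := Real.sigmoid_pos (π * x)
    have hs1 : 1 - Real.sigmoid (π * x) = Real.sigmoid (π * x) * Real.exp (-(π * x)) := by
      rw [Real.sigmoid_mul_rexp_neg, Real.sigmoid_neg]
    have hs2 : (1 - (Real.sigmoid (π * x) : ℂ)) =
        ((Real.sigmoid (π * x) * Real.exp (-(π * x)) : ℝ) : ℂ) := by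
      rw [← hs1]; push_cast; ring
    unfold kern
    rw [hs1, hs2, hs_eq]
    generalize Real.sigmoid (π * x) = s at *
    have hpos : 0 < s * Real.exp (-(π * x)) := by positivity
    have hpp := Real.pi_pos
    rw [abs_of_pos (by positivity), Complex.real_smul]
    have e1 : (s : ℂ) = Complex.exp (Real.log s : ℝ) := by
      rw [← Complex.ofReal_exp, Real.exp_log hs]
    have e2 : ((s * Real.exp (-(π * x)) : ℝ) : ℂ) = Complex.exp ((Real.log s - π * x : ℝ)) := by
      rw [← Complex.ofReal_exp, sub_eq_add_neg, Real.exp_add, Real.exp_log hs]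
    have hne1 : (s : ℂ) ≠ 0 := by exact_mod_cast hs.ne'
    have hne2 : ((s * Real.exp (-(π * x)) : ℝ) : ℂ) ≠ 0 := by exact_mod_cast hpos.ne'
    rw [Complex.cpow_def_of_ne_zero hne1, Complex.cpow_def_of_ne_zero hne2,
      ← Complex.ofReal_log hs.le, ← Complex.ofReal_log hpos.le,
      Real.log_mul hs.ne' (Real.exp_pos _).ne', Real.log_exp]
    rw [Complex.ofReal_mul, Complex.ofReal_mul, e2, e1, Complex.ofReal_mul, e1]
    rw [Complex.ofReal_exp, pow_zero, one_mul]
    have : ∀ A B C D E F G : ℂ, A + B + C + D = E + (F + G) →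
      Complex.exp A * Complex.exp B * π * (Complex.exp C * Complex.exp D)
       = π * (Complex.exp E * (Complex.exp F * Complex.exp G)) := by
      intro A B C D E F G h
      rw [← Complex.exp_add F, ← Complex.exp_add E, ← h, Complex.exp_add, Complex.exp_add,
        Complex.exp_add]
      ring
    apply this
    rw [ha]
    push_cast
    field_simp
    ring
  rw [integral_congr_ae (Filter.Eventually.of_forall hpt), integral_const_mul] at hB
  have := mul_left_cancel₀ hpi (show (π : ℂ) * (Complex.cosh w)⁻¹ = _ by rw [← hB]; rfl)
  rw [← this]; simp

/-- Successive derivatives propagate. -/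
lemma G_step (n : ℕ) (f f' : ℝ → ℝ) (c : ℂ) (h : ∀ w, ∫ x, kern n w x = c * (f w : ℂ))
    (hf : ∀ w, HasDerivAt f (f' w) w) (w : ℝ) :
    ∫ x, kern (n + 1) w x = (-Complex.I * c) * (f' w : ℂ) := by
  have h1 := G_deriv n w
  rw [funext h] at h1
  have h2 := ((hf w).ofReal_comp).const_mul c
  have h3 := h1.unique h2
  linear_combination (-Complex.I) * h3 + (∫ x, kern (n + 1) w x) * Complex.I_sq

lemma sech_deriv (w : ℝ) : HasDerivAt (fun w => (Real.cosh w)⁻¹)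
    (-Real.sinh w * (Real.cosh w)⁻¹ ^ 2) w := by
  convert! (Real.hasDerivAt_cosh w).inv (Real.cosh_pos w).ne' using 1
  rw [div_eq_mul_inv, inv_pow]

theorem gchs_characteristic_function (β ω : ℝ) :
    ∫ x : ℝ, Complex.exp (Complex.I * ω * x) * ((gchs x β : ℝ) : ℂ)
      = (((Real.cosh ω)⁻¹ : ℝ) : ℂ) *
          (1 + ((β : ℂ) / 24) * ((Real.tanh ω : ℝ) : ℂ) ^ 4) := by
  have hc : ∀ w, Real.cosh w * (Real.cosh w)⁻¹ = 1 := fun w =>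
    mul_inv_cancel₀ (Real.cosh_pos w).ne'
  have g0 : ∀ w, ∫ x, kern 0 w x = 1 * (((Real.cosh w)⁻¹ : ℝ) : ℂ) := fun w => by
    rw [G_zero, one_mul]
  have g1 := G_step 0 _ _ 1 g0 sech_deriv
  have g2 := G_step 1 _ (fun w => (Real.cosh w)⁻¹ - 2 * (Real.cosh w)⁻¹ ^ 3) _ g1 (fun w => by
    convert! (Real.hasDerivAt_sinh w).neg.mul ((sech_deriv w).pow 2) using 1
    have h := hc w
    have hs := Real.sinh_sq w
    simp only [Pi.neg_apply, Pi.pow_apply]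
    generalize (Real.cosh w)⁻¹ = s at *
    generalize Real.cosh w = c at *
    generalize Real.sinh w = t at *
    push_cast
    norm_num
    ring_nf
    rw [hs]
    grind)
  have g3 := G_step 2 _ _ _ g2 (fun w =>
    (sech_deriv w).sub (((sech_deriv w).pow 3).const_mul 2))
  have g4 := G_step 3 _ (fun w => (Real.cosh w)⁻¹ - 20 * (Real.cosh w)⁻¹ ^ 3
      + 24 * (Real.cosh w)⁻¹ ^ 5) _ g3 (fun w => by
    have hd : HasDerivAt (fun w => -Real.sinh w * (Real.cosh w)⁻¹ ^ 2
        + 6 * (Real.sinh w * (Real.cosh w)⁻¹ ^ 4)) _ w :=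
      ((Real.hasDerivAt_sinh w).neg.mul ((sech_deriv w).pow 2)).add
      (((Real.hasDerivAt_sinh w).mul ((sech_deriv w).pow 4)).const_mul 6)
    convert! hd using 1
    · funext w
      norm_num
      ring
    have h := hc w
    have hs := Real.sinh_sq w
    simp only [Pi.neg_apply, Pi.pow_apply]
    generalize (Real.cosh w)⁻¹ = s at *
    generalize Real.cosh w = c at *
    generalize Real.sinh w = t at *
    push_cast
    norm_num
    ring_nf
    rw [hs]
    grind)
  have hfun : ∀ x : ℝ, Complex.exp (Complex.I * ω * x) * ((gchs x β : ℝ) : ℂ) =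
      (1 + β / 64) * kern 0 ω x + (-(14 * β / 576)) * kern 2 ω x + (β / 576) * kern 4 ω x := by
    intro x
    unfold gchs kern
    push_cast
    ring
  have i0 := (kern_int 0 ω).const_mul (1 + (β : ℂ) / 64)
  have i2 := (kern_int 2 ω).const_mul (-(14 * (β : ℂ) / 576))
  have i4 := (kern_int 4 ω).const_mul ((β : ℂ) / 576)
  have i02 : Integrable (fun x => (1 + (β : ℂ) / 64) * kern 0 ω x
      + (-(14 * (β : ℂ) / 576)) * kern 2 ω x) := i0.add i2
  rw [integral_congr_ae (Filter.Eventually.of_forall hfun), integral_add i02 i4,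
    integral_add i0 i2, integral_const_mul, integral_const_mul, integral_const_mul, g0, g2, g4]
  have ht : Real.tanh ω ^ 4 = (1 - (Real.cosh ω)⁻¹ ^ 2) ^ 2 := by
    have h := hc ω
    have hs := Real.sinh_sq ω
    have : Real.tanh ω ^ 2 = 1 - (Real.cosh ω)⁻¹ ^ 2 := by
      rw [Real.tanh_eq_sinh_div_cosh, div_eq_mul_inv, mul_pow, hs]
      linear_combination (Real.cosh ω * (Real.cosh ω)⁻¹ + 1) * h
    rw [← this]; ring
  rw [← Complex.ofReal_pow, ht]
  have hI := Complex.I_sq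
  push_cast
  generalize (Complex.cosh (ω : ℂ))⁻¹ = s
  have hI4 : Complex.I ^ 4 = 1 := Complex.I_pow_four
  ring_nf
  simp only [hI, hI4]
  ring
end
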